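/- Let p be a prime, β a primitive p-th root of unity in ℂ, and A_s, B_s (0 ≤ s ≤ r−1) the matrices in U_{p^r}(ℂ) defined as above. Then the images of the A_s and B_s in PGL_{p^r}(ℂ) generate an elementary abelian p-group of order p^{2r}. -/

import Mathlib

open Matrix

lemma dig_add (p s t j c : ℕ) (hp : 0 < p) (h : (j + c * p ^ s) / p ^ (s+1) = j / p ^ (s+1)) :
    (((j + c * p ^ s) / p ^ t : ℕ) : ZMod p) = ((j / p ^ t : ℕ) : ZMod p) + if t = s then (c : ZMod p) else 0 := by
  rcases lt_trichotomy t s with hts | hts | hts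
  · obtain ⟨k, rfl⟩ : ∃ k, s = t + (k + 1) := ⟨s - t - 1, by omega⟩
    have : c * p ^ (t + (k+1)) = p ^ t * (c * p ^ k * p) := by ring
    rw [this, Nat.add_mul_div_left _ _ (pow_pos hp t)]
    simp
  · subst hts
    rw [Nat.add_mul_div_right _ _ (pow_pos hp t)]
    simp
  · obtain ⟨k, rfl⟩ : ∃ k, t = s + 1 + k := ⟨t - (s+1), by omega⟩
    rw [pow_add p (s+1) k, ← Nat.div_div_eq_div_mul, h, Nat.div_div_eq_div_mul]
    simp [show s + 1 + k ≠ s by omega]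

lemma dig_sigma (p s t i y : ℕ) (hp : 0 < p)
    (hy : y = if i % p ^ (s + 1) < (p - 1) * p ^ s then i + p ^ s else i - (p - 1) * p ^ s) :
    ((y / p ^ t : ℕ) : ZMod p) = ((i / p ^ t : ℕ) : ZMod p) + if t = s then 1 else 0 := by
  have hP : p ^ (s+1) = (p - 1) * p ^ s + p ^ s := by
    obtain ⟨q, rfl⟩ : ∃ q, p = q + 1 := ⟨p - 1, by omega⟩
    simp; ring
  have hpos : 0 < p ^ (s+1) := pow_pos hp _
  have hm := Nat.mod_lt i hpos
  have hd := Nat.div_add_mod i (p ^ (s+1))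
  have hle := Nat.mod_le i (p ^ (s+1))
  generalize hmm : i % p ^ (s+1) = m at *
  generalize hqq : i / p ^ (s+1) = q at *
  split_ifs at hy with hc
  · subst hy
    have := dig_add p s t i 1 hp (by
      rw [one_mul, hqq]
      refine Nat.div_eq_of_lt_le ?_ ?_
      · rw [mul_comm q]; omega
      · rw [Nat.succ_mul, mul_comm q]; omega)
    simpa using this
  · have hi : i = y + (p - 1) * p ^ s := by
      omega
    have := dig_add p s t y (p-1) hp (by
      rw [← hi, hqq]; symm
      refine Nat.div_eq_of_lt_le ?_ ?_
      · rw [mul_comm q]; omega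
      · rw [Nat.succ_mul, mul_comm q]; omega)
    rw [← hi] at this
    rw [this, Nat.cast_sub (by omega : 1 ≤ p)]
    split_ifs <;> simp

/-- digits -/
def dig (p r : ℕ) (i : Fin (p ^ r)) : Fin r → ZMod p := fun s => (((i : ℕ) / p ^ (s : ℕ) : ℕ) : ZMod p)

lemma dig_bij (p r : ℕ) [NeZero p] : Function.Bijective (dig p r) := by
  rw [Fintype.bijective_iff_injective_and_card]
  refine ⟨fun i j h => ?_, by simp [ZMod.card]⟩
  have key : ∀ k ≤ r, (i : ℕ) % p ^ k = (j : ℕ) % p ^ k := by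
    intro k
    induction k with
    | zero => intro _; simp [Nat.mod_one]
    | succ k ih =>
      intro hk
      have h1 := congrFun h ⟨k, hk⟩
      simp only [dig] at h1
      rw [ZMod.natCast_eq_natCast_iff'] at h1
      rw [Nat.mod_pow_succ, Nat.mod_pow_succ, ih (by omega), h1]
  have := key r le_rfl
  rw [Nat.mod_eq_of_lt i.2, Nat.mod_eq_of_lt j.2] at this
  exact Fin.ext this

section weyl
variable {n V : Type*} [Fintype n] [DecidableEq n] {p r : ℕ}

/-- Weyl matrices -/
noncomputable def weyl (e : n ≃ (Fin r → ZMod p)) (χ : AddChar (ZMod p) ℂ)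
    (x : (Fin r → ZMod p) × (Fin r → ZMod p)) : Matrix n n ℂ :=
  fun i j => if e.symm (e i + x.2) = j then χ (x.1 ⬝ᵥ e i) else 0

lemma weyl_mul (e : n ≃ (Fin r → ZMod p)) (χ : AddChar (ZMod p) ℂ)
    (x y : (Fin r → ZMod p) × (Fin r → ZMod p)) :
    weyl e χ x * weyl e χ y = χ (y.1 ⬝ᵥ x.2) • weyl e χ (x + y) := by
  ext i k
  simp only [weyl, Matrix.mul_apply, ite_mul, zero_mul, Finset.sum_ite_eq, Finset.mem_univ, if_true,
    Matrix.smul_apply, Equiv.apply_symm_apply, Prod.snd_add, Prod.fst_add, add_assoc, smul_eq_mul]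
  split_ifs
  · simp only [dotProduct_add, add_dotProduct, AddChar.map_add_eq_mul]; ring
  · simp

lemma weyl_zero (e : n ≃ (Fin r → ZMod p)) (χ : AddChar (ZMod p) ℂ) : weyl e χ 0 = 1 := by
  ext i k
  simp [weyl, Matrix.one_apply]

lemma weyl_ne [Nonempty n] (e : n ≃ (Fin r → ZMod p)) (χ : AddChar (ZMod p) ℂ) (x) : weyl e χ x ≠ 0 := by
  intro h
  obtain ⟨i⟩ := ‹Nonempty n›
  have := congrFun (congrFun h i) (e.symm (e i + x.2))
  simp only [weyl, if_true, Matrix.zero_apply] at this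
  exact (χ.val_isUnit _).ne_zero this

/-- Weyl units -/
noncomputable def weylU (e : n ≃ (Fin r → ZMod p)) (χ : AddChar (ZMod p) ℂ)
    (x : (Fin r → ZMod p) × (Fin r → ZMod p)) : GL n ℂ where
  val := weyl e χ x
  inv := χ (x.1 ⬝ᵥ x.2) • weyl e χ (-x)
  val_inv := by
    rw [Matrix.mul_smul, weyl_mul, smul_smul, ← AddChar.map_add_eq_mul]; simp [weyl_zero]
  inv_val := by
    rw [Matrix.smul_mul, weyl_mul, smul_smul, ← AddChar.map_add_eq_mul]; simp [weyl_zero]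

lemma scalar_mem_center (g : GL n ℂ) (c : ℂ) (h : (g : Matrix n n ℂ) = c • 1) :
    g ∈ Subgroup.center (GL n ℂ) := by
  rw [Subgroup.mem_center_iff]
  intro k
  ext1
  simp [h]

/-- Weyl hom -/
noncomputable def weylHom (e : n ≃ (Fin r → ZMod p)) (χ : AddChar (ZMod p) ℂ) :
    Multiplicative ((Fin r → ZMod p) × (Fin r → ZMod p)) →* GL n ℂ ⧸ Subgroup.center (GL n ℂ) :=
  MonoidHom.mk' (fun x => QuotientGroup.mk (weylU e χ x.toAdd)) (by
    intro x y
    rw [← QuotientGroup.mk_mul, QuotientGroup.eq]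
    apply scalar_mem_center _ (χ (y.toAdd.1 ⬝ᵥ x.toAdd.2))
    have h : ((weylU e χ x.toAdd * weylU e χ y.toAdd : GL n ℂ) : Matrix n n ℂ) =
      χ (y.toAdd.1 ⬝ᵥ x.toAdd.2) • (weylU e χ (x * y).toAdd : Matrix n n ℂ) := weyl_mul e χ _ _
    rw [Units.val_mul, h, Matrix.mul_smul, Units.inv_mul])

lemma weylHom_inj [Nonempty n] (e : n ≃ (Fin r → ZMod p)) (χ : AddChar (ZMod p) ℂ)
    (hχ : Function.Injective χ) : Function.Injective (weylHom e χ) := by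
  rw [injective_iff_map_eq_one]
  intro x hx
  have hc : weylU e χ x.toAdd ∈ Subgroup.center (GL n ℂ) := (QuotientGroup.eq_one_iff _).1 hx
  rw [Subgroup.mem_center_iff] at hc
  have hall : ∀ y : (Fin r → ZMod p) × (Fin r → ZMod p),
      x.toAdd.1 ⬝ᵥ y.2 = y.1 ⬝ᵥ x.toAdd.2 := by
    intro y
    have h : weyl e χ y * weyl e χ x.toAdd = weyl e χ x.toAdd * weyl e χ y :=
      congrArg Units.val (hc (weylU e χ y))
    rw [weyl_mul, weyl_mul, add_comm y] at h
    exact hχ (smul_left_injective ℂ (weyl_ne e χ _) h)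
  have h1 : x.toAdd.1 = 0 := by
    ext s
    simpa using hall (0, Pi.single s 1)
  have h2 : x.toAdd.2 = 0 := by
    ext s
    simpa using (hall (Pi.single s 1, 0)).symm
  exact Multiplicative.toAdd.injective (Prod.ext h1 h2)
end weyl

lemma hom_mem {G : Type*} [Group G] {p r : ℕ} [NeZero p] (H : Subgroup G)
    (f : Multiplicative (Fin r → ZMod p) →* G)
    (h : ∀ s, f (Multiplicative.ofAdd (Pi.single s 1)) ∈ H) (x) : f x ∈ H := by
  have hx : x = ∏ s, (Multiplicative.ofAdd (Pi.single s (1 : ZMod p))) ^ (x.toAdd s).val := by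
    apply Multiplicative.toAdd.injective
    rw [toAdd_prod]
    simp only [toAdd_pow, toAdd_ofAdd]
    ext t
    simp only [Finset.sum_apply, Pi.smul_apply]
    simp [Pi.single_apply]
  have hcomap : x ∈ H.comap f := by
    rw [hx]
    exact Subgroup.prod_mem _ fun s _ => Subgroup.pow_mem (H.comap f) (Subgroup.mem_comap.2 (h s)) _
  exact hcomap

/-- the images of the matrices `A_s` and `B_s` (`0 ≤ s ≤ r-1`) in
`PGL_{p^r}(ℂ) = GL_{p^r}(ℂ)/Z` generate an elementary abelian `p`-group of order `p^{2r}`. -/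
theorem stmt1 (p r : ℕ) (hp : p.Prime) (β : ℂ) (hβ : IsPrimitiveRoot β p)
    (σ : ℕ → Fin (p ^ r) → Fin (p ^ r))
    (hσ : ∀ s < r, ∀ i : Fin (p ^ r),
      ((σ s i : ℕ) = if (i : ℕ) % p ^ (s + 1) < (p - 1) * p ^ s
        then (i : ℕ) + p ^ s else (i : ℕ) - (p - 1) * p ^ s))
    (A B : ℕ → GL (Fin (p ^ r)) ℂ)
    (hA : ∀ s < r, (A s : Matrix (Fin (p ^ r)) (Fin (p ^ r)) ℂ) =
      Matrix.diagonal (fun i : Fin (p ^ r) => β ^ ((i : ℕ) / p ^ s)))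
    (hB : ∀ s < r, ∀ i j : Fin (p ^ r),
      (B s : Matrix (Fin (p ^ r)) (Fin (p ^ r)) ℂ) i j = if σ s i = j then 1 else 0) :
    let H : Subgroup (GL (Fin (p ^ r)) ℂ ⧸ Subgroup.center (GL (Fin (p ^ r)) ℂ)) :=
      Subgroup.closure
        {x | ∃ s < r, x = QuotientGroup.mk (A s) ∨ x = QuotientGroup.mk (B s)}
    (∀ g ∈ H, g ^ p = 1) ∧ (∀ a ∈ H, ∀ b ∈ H, a * b = b * a) ∧
      Nat.card H = p ^ (2 * r) := by
  intro H
  have : Fact p.Prime := ⟨hp⟩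
  have : NeZero p := ⟨hp.ne_zero⟩
  have : Nonempty (Fin (p ^ r)) := ⟨⟨0, pow_pos hp.pos r⟩⟩
  let e := Equiv.ofBijective _ (dig_bij p r)
  let χ : AddChar (ZMod p) ℂ := AddChar.zmodChar p hβ.pow_eq_one
  have hχ : Function.Injective χ := by
    intro a b hab
    simp only [χ, AddChar.zmodChar_apply] at hab
    exact ZMod.val_injective p (hβ.pow_inj (ZMod.val_lt a) (ZMod.val_lt b) hab)
  have he : ∀ i, e i = dig p r i := fun i => rfl
  have hAe : ∀ s : Fin r, A s = weylU e χ (Pi.single s 1, 0) := by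
    intro s
    apply Units.ext
    rw [hA s s.2]
    ext i j
    have : χ (dig p r i s) = β ^ ((i : ℕ) / p ^ (s : ℕ)) := by
      simp only [χ, dig]
      exact AddChar.zmodChar_apply' _ _
    have h2 : e.symm (dig p r i) = i := e.symm_apply_apply i
    simp [weylU, weyl, Matrix.diagonal_apply, he, this, h2]
  have hBe : ∀ s : Fin r, B s = weylU e χ (0, Pi.single s 1) := by
    intro s
    apply Units.ext
    ext i j
    rw [hB s s.2]
    have : e (σ s i) = e i + Pi.single s 1 := by
      ext t
      simp only [he, dig, Pi.add_apply, Pi.single_apply, Fin.ext_iff]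
      exact dig_sigma p s t i _ hp.pos (hσ s s.2 i)
    simp [weylU, weyl, ← this]
  have hH : H = (weylHom e χ).range := by
    apply le_antisymm
    · refine (Subgroup.closure_le _).2 ?_
      rintro x ⟨s, hs, rfl | rfl⟩
      · exact ⟨Multiplicative.ofAdd (Pi.single ⟨s, hs⟩ 1, 0),
          congrArg QuotientGroup.mk (hAe ⟨s, hs⟩).symm⟩
      · exact ⟨Multiplicative.ofAdd (0, Pi.single ⟨s, hs⟩ 1),
          congrArg QuotientGroup.mk (hBe ⟨s, hs⟩).symm⟩
    · rintro _ ⟨x, rfl⟩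
      have hx : x = Multiplicative.ofAdd (x.toAdd.1, 0) * Multiplicative.ofAdd (0, x.toAdd.2) := by
        apply Multiplicative.toAdd.injective
        simp
      rw [hx, map_mul]
      refine H.mul_mem ?_ ?_
      · refine hom_mem H ((weylHom e χ).comp (AddMonoidHom.inl _ _).toMultiplicative) ?_
          (Multiplicative.ofAdd x.toAdd.1)
        intro s
        exact Subgroup.subset_closure ⟨s, s.2, Or.inl (congrArg QuotientGroup.mk (hAe s).symm)⟩
      · refine hom_mem H ((weylHom e χ).comp (AddMonoidHom.inr _ _).toMultiplicative) ?_
          (Multiplicative.ofAdd x.toAdd.2)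
        intro s
        exact Subgroup.subset_closure ⟨s, s.2, Or.inr (congrArg QuotientGroup.mk (hBe s).symm)⟩
  rw [hH]
  refine ⟨?_, ?_, ?_⟩
  · rintro _ ⟨x, rfl⟩
    rw [← map_pow]
    have : x ^ p = 1 := by
      apply Multiplicative.toAdd.injective
      rw [toAdd_pow, toAdd_one]
      ext s <;> simp
    rw [this, map_one]
  · rintro _ ⟨x, rfl⟩ _ ⟨y, rfl⟩
    rw [← map_mul, mul_comm, map_mul]
  · rw [← Nat.card_congr (MonoidHom.ofInjective (weylHom_inj e χ hχ)).toEquiv]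
    simp [Nat.card_eq_fintype_card, ZMod.card]
    ring
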